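/- In the ring R = Z[1/3][a1, a3], the element a1^3 - 27*a3 is irreducible, and every unit of the localization R[Δ^{-1}] with Δ = a3^3*(a1^3 - 27*a3) is of the form ±3^k * a3^m * (a1^3 - 27*a3)^n with k, m, n ∈ Z. In particular, if R[Δ^{-1}] is graded by |a1| = 1, |a3| = 3, every homogeneous unit has degree divisible by 3. -/

import Mathlib

open MvPolynomial

noncomputable section

/-- `A = ℤ[1/3]`. -/
abbrev A16 : Type := Localization.Away (3 : ℤ)

/-- `R = ℤ[1/3][a₁, a₃]`, with `a₁ = X 0` and `a₃ = X 1`. -/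
abbrev R16 : Type := MvPolynomial (Fin 2) A16

/-- `f = a₁³ - 27 a₃`. -/
def f16 : R16 := X 0 ^ 3 - 27 * X 1

/-- `Δ = a₃³ (a₁³ - 27 a₃)`. -/
def Δ16 : R16 := X 1 ^ 3 * f16

/-- `R[Δ⁻¹]`. -/
abbrev S16 : Type := Localization.Away Δ16

instance : CommRing S16 :=
  OreLocalization.instCommRing (R := R16) (S := Submonoid.powers Δ16)

/-- An element of `ℤ[1/3]` is a unit only if it is `± 3^k`, written without negative powers. -/
theorem exists_mul_three_pow_eq_of_isUnit {a : A16} (ha : IsUnit a) :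
    ∃ i l : ℕ, a * 3 ^ i = 3 ^ l ∨ a * 3 ^ i = -3 ^ l := by
  have h3 : algebraMap ℤ A16 3 = 3 := map_ofNat _ 3
  have hinj : Function.Injective (algebraMap ℤ A16) :=
    IsLocalization.injective A16 (powers_le_nonZeroDivisors_of_noZeroDivisors (by norm_num : (3 : ℤ) ≠ 0))
  obtain ⟨b, hab⟩ := ha.exists_right_inv
  obtain ⟨i, n, hn⟩ := IsLocalization.Away.surj (3 : ℤ) a
  obtain ⟨j, m, hm⟩ := IsLocalization.Away.surj (3 : ℤ) b
  have hnm : n * m = 3 ^ (i + j) := by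
    apply hinj
    rw [map_mul, ← hn, ← hm, map_pow, pow_add]
    linear_combination (algebraMap ℤ A16 3 ^ i * algebraMap ℤ A16 3 ^ j) * hab
  obtain ⟨l, -, hl⟩ := (dvd_prime_pow Int.prime_three _).1 (Dvd.intro _ hnm)
  refine ⟨i, l, ?_⟩
  rw [← h3, hn]
  rcases Int.associated_iff.1 hl with h | h <;> simp [h]

instance : IsDomain A16 :=
  IsLocalization.isDomain_localization
    (powers_le_nonZeroDivisors_of_noZeroDivisors (by norm_num : (3 : ℤ) ≠ 0))

theorem isUnit_three_A16 : IsUnit (3 : A16) := by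
  have h := IsLocalization.Away.algebraMap_isUnit (S := A16) (3 : ℤ)
  rwa [map_ofNat] at h

/-- `f16` is the image of `X 1` under an automorphism of `ℤ[1/3][a₁, a₃]`. -/
theorem prime_f16 : Prime f16 := by
  obtain ⟨c, hc⟩ := isUnit_three_A16.exists_right_inv
  have hC : (27 : R16) * C (c ^ 3) = 1 := by
    have h27 : (27 : R16) = C 27 := (map_ofNat C 27).symm
    rw [h27, ← C_mul, ← C_1]
    congr 1
    linear_combination (9 * c ^ 2 + 3 * c + 1) * hc
  let φ : R16 →ₐ[A16] R16 := aeval ![X 0, f16]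
  let ψ : R16 →ₐ[A16] R16 := aeval ![X 0, C (c ^ 3) * (X 0 ^ 3 - X 1)]
  have hφ0 : φ (X 0) = X 0 := by simp [φ]
  have hφ1 : φ (X 1) = f16 := by simp [φ]
  have hψ0 : ψ (X 0) = X 0 := by simp [ψ]
  have hψ1 : ψ (X 1) = C (c ^ 3) * (X 0 ^ 3 - X 1) := by simp [ψ]
  have hφC : φ (C (c ^ 3)) = C (c ^ 3) := φ.commutes _
  have hφψ : φ.comp ψ = AlgHom.id A16 R16 := by
    ext1 i
    fin_cases i
    · change φ (ψ (X 0)) = X 0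
      rw [hψ0, hφ0]
    · change φ (ψ (X 1)) = X 1
      rw [hψ1, map_mul, hφC, map_sub, map_pow φ (X 0), hφ0, hφ1, f16]
      linear_combination X 1 * hC
  have hψφ : ψ.comp φ = AlgHom.id A16 R16 := by
    ext1 i
    fin_cases i
    · change ψ (φ (X 0)) = X 0
      rw [hφ0, hψ0]
    · change ψ (φ (X 1)) = X 1
      rw [hφ1, f16, map_sub, map_pow, map_mul, map_ofNat, hψ0, hψ1]
      linear_combination (X 1 - X 0 ^ 3) * hC
  have hX : Prime (X 1 : R16) := X_prime
  have h := (MulEquiv.prime_iff (AlgEquiv.ofAlgHom φ ψ hφψ hψφ)).2 hX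
  change Prime (φ (X 1)) at h
  rwa [hφ1] at h

theorem Δ16_ne_zero : Δ16 ≠ 0 :=
  mul_ne_zero (pow_ne_zero _ (X_ne_zero _)) prime_f16.ne_zero

theorem algebraMap_R16_injective : Function.Injective (algebraMap R16 S16) :=
  IsLocalization.injective (M := Submonoid.powers Δ16) S16
    (powers_le_nonZeroDivisors_of_noZeroDivisors Δ16_ne_zero)

theorem eq_C_mul_of_mul_eq_Δ16_pow {p q : R16} {N : ℕ} (h : p * q = Δ16 ^ N) :
    ∃ (a : A16) (j i : ℕ), IsUnit a ∧ p = C a * X 1 ^ j * f16 ^ i := by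
  have hX : Prime (X 1 : R16) := X_prime
  rw [Δ16, mul_pow, ← pow_mul] at h
  obtain ⟨i, -, b, c, -, hbc, rfl, -⟩ := mul_eq_mul_prime_pow prime_f16 h
  obtain ⟨j, -, hj⟩ := (dvd_prime_pow hX _).1 (Dvd.intro _ hbc.symm)
  obtain ⟨v, hv⟩ := hj.symm
  obtain ⟨a, ha, hav⟩ := isUnit_iff_eq_C_of_isReduced.1 v.isUnit
  exact ⟨a, j, i, ha, by rw [← hv, hav]; ring⟩

/-- A numerator of a unit of `R[Δ⁻¹]` is `c a₃^j f^i` with `c` a unit of `ℤ[1/3]`. -/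
theorem numerator_eq_of_unit (u : S16ˣ) {p : R16} {t : ℕ}
    (h : (u : S16) * algebraMap R16 S16 Δ16 ^ t = algebraMap R16 S16 p) :
    ∃ (a : A16) (j i : ℕ), IsUnit a ∧ p = C a * X 1 ^ j * f16 ^ i := by
  obtain ⟨s, q, hq⟩ := IsLocalization.Away.surj (S := S16) Δ16 (↑u⁻¹ : S16)
  refine eq_C_mul_of_mul_eq_Δ16_pow (q := q) (N := t + s) (algebraMap_R16_injective ?_)
  rw [map_mul, ← h, ← hq, map_pow, pow_add]
  linear_combination
    (algebraMap R16 S16 Δ16 ^ t * algebraMap R16 S16 Δ16 ^ s) * u.mul_inv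

theorem isWeightedHomogeneous_X_one :
    IsWeightedHomogeneous ![1, 3] (X 1 : R16) 3 :=
  isWeightedHomogeneous_X A16 ![1, 3] 1

theorem isWeightedHomogeneous_f16 : IsWeightedHomogeneous ![1, 3] f16 3 := by
  have h0 : IsWeightedHomogeneous ![1, 3] (X 0 ^ 3 : R16) 3 :=
    (isWeightedHomogeneous_X A16 ![1, 3] 0).pow 3
  have h1 : IsWeightedHomogeneous ![1, 3] (C (-27) * X 1 : R16) 3 := by
    simpa using (isWeightedHomogeneous_C ![1, 3] (-27 : A16)).mul isWeightedHomogeneous_X_one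
  have h27 : (C 27 : R16) = 27 := map_ofNat C 27
  have hf : f16 = X 0 ^ 3 + C (-27) * X 1 := by
    rw [f16, C_neg, h27]
    ring
  rw [hf]
  exact h0.add h1

/-- In `R = ℤ[1/3][a₁, a₃]`, the element `a₁³ - 27 a₃` is irreducible, and every unit
of `R[Δ⁻¹]` (with `Δ = a₃³(a₁³ - 27a₃)`) is of the form `± 3^k a₃^m (a₁³ - 27a₃)^n`
with `k, m, n : ℤ` (powers taken of the corresponding units `u3, ua3, uf` of the
localization).  In particular, grading `R[Δ⁻¹]` by `|a₁| = 1`, `|a₃| = 3`, every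
homogeneous unit has degree divisible by 3: if a unit `u` is homogeneous of degree
`d : ℤ`, i.e. `u * Δ^t` is the image of a polynomial `p` that is weighted
homogeneous of weighted degree `e = d + 12 t` (note `|Δ| = 12`), then `3 ∣ d`. -/
theorem stmt16 (u3 ua3 uf : S16ˣ)
    (hu3 : (u3 : S16) = algebraMap R16 S16 (3 : R16))
    (hua3 : (ua3 : S16) = algebraMap R16 S16 (X 1))
    (huf : (uf : S16) = algebraMap R16 S16 f16) :
    Irreducible f16 ∧
    (∀ u : S16ˣ, ∃ k m n : ℤ,
      u = u3 ^ k * ua3 ^ m * uf ^ n ∨ u = -(u3 ^ k * ua3 ^ m * uf ^ n)) ∧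
    (∀ (u : S16ˣ) (d : ℤ) (p : R16) (t e : ℕ),
      IsWeightedHomogeneous ![1, 3] p e → (e : ℤ) = d + 12 * t →
      (u : S16) * algebraMap R16 S16 Δ16 ^ t = algebraMap R16 S16 p →
      (3 : ℤ) ∣ d) := by
  refine ⟨prime_f16.irreducible, fun u => ?_, fun u d p t e hp he hu => ?_⟩
  · obtain ⟨t, p, hp⟩ := IsLocalization.Away.surj (S := S16) Δ16 (u : S16)
    obtain ⟨a, j, i, ha, rfl⟩ := numerator_eq_of_unit u hp
    obtain ⟨r, l, hrl⟩ := exists_mul_three_pow_eq_of_isUnit ha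
    have hC3 : (C 3 : R16) = 3 := map_ofNat C 3
    have hΔ : algebraMap R16 S16 Δ16 = (ua3 : S16) ^ 3 * uf := by
      rw [hua3, huf, ← map_pow, ← map_mul]
      rfl
    rw [map_mul, map_mul, map_pow, map_pow, ← hua3, ← huf, hΔ] at hp
    have key (w : S16ˣ) (hw : algebraMap R16 S16 (C (a * 3 ^ r)) = w) :
        u = w * (u3 ^ (-r : ℤ) * ua3 ^ (j - 3 * t : ℤ) * uf ^ (i - t : ℤ)) := by
      have hw' : algebraMap R16 S16 (C a) * (u3 : S16) ^ r = w := by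
        rw [← hw, hu3, C_mul, C_pow, hC3, map_mul, map_pow]
      have hmul : u * (ua3 ^ 3 * uf) ^ t * u3 ^ r = w * ua3 ^ j * uf ^ i := by
        ext
        push_cast
        rw [hp, ← hw']
        ring
      have hu : u = w * ua3 ^ j * uf ^ i * (u3 ^ r)⁻¹ * ((ua3 ^ 3 * uf) ^ t)⁻¹ := by
        rw [← hmul]
        group
      rw [hu, zpow_sub, zpow_sub, zpow_neg, zpow_mul, mul_pow, mul_inv]
      simp only [zpow_natCast, zpow_ofNat]
      simp only [mul_comm, mul_left_comm, mul_assoc]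
    refine ⟨l - r, j - 3 * t, i - t, ?_⟩
    rcases hrl with h | h
    · left
      rw [key (u3 ^ l) (by rw [h, C_pow, hC3, map_pow, Units.val_pow_eq_pow_val, hu3]),
        zpow_sub u3, zpow_neg, zpow_natCast]
      simp only [mul_assoc, zpow_natCast]
    · right
      rw [key (-u3 ^ l) (by
          rw [h, C_neg, C_pow, hC3, map_neg, map_pow, Units.val_neg,
            Units.val_pow_eq_pow_val, hu3]),
        zpow_sub u3, zpow_neg, zpow_natCast]
      simp only [mul_assoc, zpow_natCast, neg_mul]
  · obtain ⟨a, j, i, ha, rfl⟩ := numerator_eq_of_unit u hu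
    have hhom := ((isWeightedHomogeneous_C ![1, 3] a).mul
      (isWeightedHomogeneous_X_one.pow j)).mul (isWeightedHomogeneous_f16.pow i)
    have hne : (C a * X 1 ^ j * f16 ^ i : R16) ≠ 0 :=
      mul_ne_zero (mul_ne_zero (C_ne_zero.2 ha.ne_zero) (pow_ne_zero _ (X_ne_zero _)))
        (pow_ne_zero _ prime_f16.ne_zero)
    have hdeg := IsWeightedHomogeneous.inj_right hne hp hhom
    simp only [smul_eq_mul] at hdeg
    omega

end
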